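/- Let β ∈ (1,2) and let g : ℝ² → ℝ be continuously differentiable with compact support. Then for every x ∈ ℝ² the principal value lim_{ε → 0⁺} ∫_{|x−y| > ε} ((x−y)^⊥ / |x−y|^{2+β}) g(y) dy exists and equals −(1/β) ∫_{ℝ²} |x−y|^{−β} ∇^⊥ g(y) dy, where (a,b)^⊥ = (−b,a) and ∇^⊥ g = (−∂₂ g, ∂₁ g). -/

import Mathlib

open MeasureTheory Filter Metric Set
open scoped Topology

noncomputable section

/-- The plane `ℝ²`. -/
abbrev R2 : Type := EuclideanSpace ℝ (Fin 2)

/-- The rotation by 90 degrees: `(a, b)^⊥ = (-b, a)`. -/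
def perp (v : R2) : R2 := (EuclideanSpace.equiv (Fin 2) ℝ).symm ![-(v 1), v 0]

/-- The kernel `K_β(z) = z^⊥ / |z|^{2+β}` of the gSQG constitutive law. -/
def gsqgKernel (β : ℝ) (z : R2) : R2 := ‖z‖ ^ (-(2 + β)) • perp z

lemma continuous_perp : Continuous perp := by
  unfold perp
  refine (EuclideanSpace.equiv (Fin 2) ℝ).symm.continuous.comp (continuous_pi fun i => ?_)
  fin_cases i <;> simp <;> fun_prop

lemma inner_perp_right (w a : R2) : inner ℝ w (perp a) = -inner ℝ a (perp w) := by
  simp [perp, PiLp.inner_apply, Fin.sum_univ_two]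
  ring

lemma norm_perp (a : R2) : ‖perp a‖ = ‖a‖ := by
  simp [perp, EuclideanSpace.norm_eq, Fin.sum_univ_two, add_comm]

lemma perp_zero : perp 0 = 0 := norm_eq_zero.1 (by rw [norm_perp, norm_zero])

lemma norm_gsqgKernel_le {β ε : ℝ} (hβ : 0 < β) (hε : 0 < ε) {z : R2} (hz : ε < ‖z‖) :
    ‖gsqgKernel β z‖ ≤ ε ^ (-(1 + β)) := by
  have hz0 : 0 < ‖z‖ := hε.trans hz
  rw [gsqgKernel, norm_smul, norm_perp, Real.norm_of_nonneg (by positivity)]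
  calc ‖z‖ ^ (-(2 + β)) * ‖z‖ = ‖z‖ ^ (-(1 + β)) := by
        rw [← Real.rpow_add_one hz0.ne']; ring_nf
    _ ≤ ε ^ (-(1 + β)) := Real.rpow_le_rpow_of_nonpos hε hz.le (by linarith)

lemma measurable_gsqgKernel (β : ℝ) : Measurable (gsqgKernel β) :=
  (measurable_norm.pow_const _).smul continuous_perp.measurable

lemma lipschitzOnWith_rpow_Ici {β ε : ℝ} (hβ : 0 < β) (hε : 0 < ε) :
    ∃ C, LipschitzOnWith C (fun r : ℝ => r ^ (-β)) (Ici ε) := by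
  refine ⟨(β * ε ^ (-β - 1)).toNNReal, (convex_Ici ε).lipschitzOnWith_of_nnnorm_deriv_le
    (fun r hr => ?_) (fun r hr => ?_)⟩
  · exact Real.differentiableAt_rpow_const_of_ne _ (hε.trans_le hr).ne'
  · have hr0 : 0 < r := hε.trans_le hr
    rw [← NNReal.coe_le_coe, coe_nnnorm, Real.coe_toNNReal _ (by positivity),
      Real.deriv_rpow_const, norm_mul, norm_neg, Real.norm_of_nonneg hβ.le,
      Real.norm_of_nonneg (by positivity)]
    exact mul_le_mul_of_nonneg_left (Real.rpow_le_rpow_of_nonpos hε hr (by linarith)) hβ.le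

/-- The Riesz potential `|z|^{-β}`, frozen at its boundary value inside the ball of radius `ε`. -/
def truncatedRiesz (β ε : ℝ) (z : R2) : ℝ := max ε ‖z‖ ^ (-β)

lemma exists_lipschitzWith_truncatedRiesz {β ε : ℝ} (hβ : 0 < β) (hε : 0 < ε) (x : R2) :
    ∃ C, LipschitzWith C (fun y => truncatedRiesz β ε (x - y)) := by
  obtain ⟨C, hC⟩ := lipschitzOnWith_rpow_Ici hβ hε
  have h : LipschitzWith 1 (fun y : R2 => max ε ‖x - y‖) := by
    simp_rw [← dist_eq_norm]
    exact (LipschitzWith.dist_right x).const_max ε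
  refine ⟨C * 1, ?_⟩
  rw [← lipschitzOnWith_univ] at h ⊢
  exact hC.comp h fun y _ => mem_Ici.2 (le_max_left _ _)

lemma hasFDerivAt_norm_sub_rpow (β : ℝ) {x y : R2} (h : x - y ≠ 0) :
    HasFDerivAt (fun y : R2 => ‖x - y‖ ^ (-β))
      ((β * ‖x - y‖ ^ (-(2 + β))) • innerSL ℝ (x - y)) y := by
  have hsq (z : R2) (p : ℝ) : (‖x - z‖ ^ 2) ^ p = ‖x - z‖ ^ (2 * p) := by
    rw [← Real.rpow_natCast, ← Real.rpow_mul (norm_nonneg _), Nat.cast_ofNat]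
  have h1 := (((hasFDerivAt_id (𝕜 := ℝ) y).const_sub x).norm_sq).rpow_const (p := -β / 2)
    (Or.inl (by simpa using h))
  simp only [id, hsq] at h1
  rw [show 2 * (-β / 2) = -β by ring, show 2 * (-β / 2 - 1) = -(2 + β) by ring] at h1
  refine h1.congr_fderiv ?_
  ext v
  simp
  ring

lemma lineDeriv_truncatedRiesz_of_lt (β : ℝ) {ε : ℝ} (hε : 0 < ε) {x y : R2}
    (h : ε < ‖x - y‖) (v : R2) :
    lineDeriv ℝ (fun y => truncatedRiesz β ε (x - y)) y v =
      β * ‖x - y‖ ^ (-(2 + β)) * inner ℝ (x - y) v := by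
  have hev : (fun y => truncatedRiesz β ε (x - y)) =ᶠ[𝓝 y] fun y => ‖x - y‖ ^ (-β) := by
    have : ∀ᶠ z in 𝓝 y, ε < ‖x - z‖ :=
      (continuous_const.sub continuous_id).norm.continuousAt.eventually (lt_mem_nhds h)
    filter_upwards [this] with z hz
    rw [truncatedRiesz, max_eq_right hz.le]
  rw [hev.lineDeriv_eq]
  exact ((hasFDerivAt_norm_sub_rpow β (norm_pos_iff.1 (hε.trans h))).hasLineDerivAt v).lineDeriv

lemma lineDeriv_truncatedRiesz_of_gt (β : ℝ) {ε : ℝ} {x y : R2}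
    (h : ‖x - y‖ < ε) (v : R2) :
    lineDeriv ℝ (fun y => truncatedRiesz β ε (x - y)) y v = 0 := by
  have hev : (fun y => truncatedRiesz β ε (x - y)) =ᶠ[𝓝 y] fun _ => ε ^ (-β) := by
    have : ∀ᶠ z in 𝓝 y, ‖x - z‖ < ε :=
      (continuous_const.sub continuous_id).norm.continuousAt.eventually (gt_mem_nhds h)
    filter_upwards [this] with z hz
    rw [truncatedRiesz, max_eq_left hz.le]
  rw [hev.lineDeriv_eq]
  exact (hasFDerivAt_const _ y).hasLineDerivAt v |>.lineDeriv

lemma truncatedRiesz_le {β ε : ℝ} (hβ : 0 < β) {z : R2} (hz : z ≠ 0) :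
    truncatedRiesz β ε z ≤ ‖z‖ ^ (-β) :=
  Real.rpow_le_rpow_of_nonpos (norm_pos_iff.2 hz) (le_max_right _ _) (by linarith)

lemma continuous_gradient {g : R2 → ℝ} (hg : ContDiff ℝ 1 g) : Continuous (gradient g) :=
  (InnerProductSpace.toDual ℝ R2).symm.continuous.comp (hg.continuous_fderiv one_ne_zero)

lemma hasCompactSupport_perp_gradient {g : R2 → ℝ} (hg : HasCompactSupport g) :
    HasCompactSupport (fun y => perp (gradient g y)) := by
  refine (hg.fderiv ℝ).comp_left (g := fun L => perp ((InnerProductSpace.toDual ℝ R2).symm L)) ?_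
  rw [map_zero, perp_zero]

lemma integrableOn_smul_gsqgKernel {β ε : ℝ} (hβ : 0 < β) (hε : 0 < ε) {g : R2 → ℝ}
    (hg : Continuous g) (hsupp : HasCompactSupport g) (x : R2) :
    IntegrableOn (fun y => g y • gsqgKernel β (x - y)) {y : R2 | ε < dist x y} := by
  have hmeas : MeasurableSet {y : R2 | ε < dist x y} :=
    (isOpen_lt continuous_const (continuous_const.dist continuous_id)).measurableSet
  refine Integrable.mono' (g := fun y => ‖g y‖ * ε ^ (-(1 + β)))
    ((hg.integrable_of_hasCompactSupport hsupp).norm.mul_const _).integrableOn ?_ ?_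
  · exact (hg.measurable.smul
      ((measurable_gsqgKernel β).comp (measurable_const.sub measurable_id))).aestronglyMeasurable
  · filter_upwards [ae_restrict_mem hmeas] with y hy
    rw [norm_smul]
    gcongr
    exact norm_gsqgKernel_le hβ hε (by rwa [← dist_eq_norm])

lemma integrable_norm_rpow_smul_perp_gradient {β : ℝ} (hβ : β < 2) {g : R2 → ℝ}
    (hg : ContDiff ℝ 1 g) (hsupp : HasCompactSupport g) (x : R2) :
    Integrable (fun y => ‖x - y‖ ^ (-β) • perp (gradient g y)) := by
  have hloc : LocallyIntegrable (fun z : R2 => ‖z‖ ^ (-β)) := by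
    refine locallyIntegrable_of_norm_le_rpow (C := 1) (α := β) (by simp) (by simpa using hβ)
      (ae_of_all _ fun z => ?_) (measurable_norm.pow_const _).aestronglyMeasurable
    rw [Real.norm_of_nonneg (by positivity), one_mul]
  have h := hloc.integrable_smul_right_of_hasCompactSupport (g := fun z => perp (gradient g (x - z)))
    (continuous_perp.comp ((continuous_gradient hg).comp (continuous_const.sub continuous_id)))
    ((hasCompactSupport_perp_gradient hsupp).comp_homeomorph (Homeomorph.subLeft x))
  simpa using h.comp_sub_left x

lemma integrable_truncatedRiesz_smul {β ε : ℝ} (hβ : 0 < β) (hε : 0 < ε) {g : R2 → ℝ}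
    (hg : ContDiff ℝ 1 g) (hsupp : HasCompactSupport g) (x : R2) :
    Integrable (fun y => truncatedRiesz β ε (x - y) • perp (gradient g y)) := by
  obtain ⟨C, hC⟩ := exists_lipschitzWith_truncatedRiesz hβ hε x
  exact (hC.continuous.smul (continuous_perp.comp (continuous_gradient hg)))
    |>.integrable_of_hasCompactSupport (hasCompactSupport_perp_gradient hsupp).smul_left

/-- Cutting the kernel off at radius `ε` produces no boundary term: the truncated potential is
Lipschitz, with almost everywhere gradient supported outside the ball of radius `ε`. -/
lemma setIntegral_smul_gsqgKernel {β ε : ℝ} (hβ : 0 < β) (hε : 0 < ε) {g : R2 → ℝ}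
    (hg : ContDiff ℝ 1 g) (hsupp : HasCompactSupport g) (x : R2) :
    ∫ y in {y : R2 | ε < dist x y}, g y • gsqgKernel β (x - y) =
      -(1 / β) • ∫ y : R2, truncatedRiesz β ε (x - y) • perp (gradient g y) := by
  have hmeas : MeasurableSet {y : R2 | ε < dist x y} :=
    (isOpen_lt continuous_const (continuous_const.dist continuous_id)).measurableSet
  obtain ⟨C, hC⟩ := exists_lipschitzWith_truncatedRiesz hβ hε x
  obtain ⟨D, hD⟩ := hg.lipschitzWith_of_hasCompactSupport hsupp one_ne_zero
  refine ext_inner_left ℝ fun w => ?_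
  have hparts := LipschitzWith.integral_lineDeriv_mul_eq (μ := volume) hC hD hsupp (perp w)
  have hleft : ∫ y, lineDeriv ℝ (fun y => truncatedRiesz β ε (x - y)) y (perp w) * g y =
      ∫ y in {y : R2 | ε < dist x y}, -β * inner ℝ w (g y • gsqgKernel β (x - y)) := by
    rw [← integral_indicator hmeas]
    refine integral_congr_ae ?_
    filter_upwards [measure_eq_zero_iff_ae_notMem.1
      (Measure.addHaar_sphere (volume : Measure R2) x ε)] with y hy
    rw [mem_sphere, dist_comm] at hy
    rcases lt_or_gt_of_ne hy with h | h
    · rw [indicator_of_notMem (by simpa using h.le),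
        lineDeriv_truncatedRiesz_of_gt β (by rwa [← dist_eq_norm]), zero_mul]
    · rw [indicator_of_mem (by exact h),
        lineDeriv_truncatedRiesz_of_lt β hε (by rwa [← dist_eq_norm]), gsqgKernel,
        inner_smul_right, inner_smul_right, inner_perp_right]
      ring
  have hright : ∫ y, lineDeriv ℝ g y (-perp w) * truncatedRiesz β ε (x - y) =
      ∫ y, inner ℝ w (truncatedRiesz β ε (x - y) • perp (gradient g y)) := by
    congr 1 with y
    have hd : DifferentiableAt ℝ g y := hg.differentiable one_ne_zero y
    rw [hd.lineDeriv_eq_fderiv, map_neg, inner_smul_right, inner_perp_right, inner_gradient_left]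
    ring
  rw [hleft, hright, integral_const_mul,
    integral_inner (integrableOn_smul_gsqgKernel hβ hε hg.continuous hsupp x),
    integral_inner (integrable_truncatedRiesz_smul hβ hε hg hsupp x)] at hparts
  rw [inner_smul_right, ← hparts]
  field_simp

/-- **Principal value integration by parts** for `β ∈ (1,2)`: for `g ∈ C¹_c(ℝ²)`
and every `x ∈ ℝ²`, the principal value
`lim_{ε→0⁺} ∫_{|x-y|>ε} ((x-y)^⊥/|x-y|^{2+β}) g(y) dy`
exists and equals `-(1/β) ∫ |x-y|^{-β} ∇^⊥g(y) dy`. -/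
theorem pv_integration_by_parts
    (β : ℝ) (hβ : β ∈ Ioo (1:ℝ) 2) (g : R2 → ℝ)
    (hg : ContDiff ℝ 1 g) (hsupp : HasCompactSupport g) :
    ∀ x : R2,
      Filter.Tendsto
        (fun ε : ℝ => ∫ y in {y : R2 | ε < dist x y}, g y • gsqgKernel β (x - y))
        (nhdsWithin (0:ℝ) (Ioi 0))
        (nhds (-(1 / β) • ∫ y : R2, (‖x - y‖ ^ (-β)) • perp (gradient g y))) := by
  intro x
  have hβ0 : 0 < β := one_pos.trans hβ.1
  have hlim : Tendsto (fun ε : ℝ => ∫ y : R2, truncatedRiesz β ε (x - y) • perp (gradient g y))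
      (𝓝[>] 0) (𝓝 (∫ y : R2, ‖x - y‖ ^ (-β) • perp (gradient g y))) := by
    have hne : ∀ᵐ y : R2, x - y ≠ 0 := by
      filter_upwards [Measure.ae_ne volume x] with y hy
      exact sub_ne_zero.2 hy.symm
    refine tendsto_integral_filter_of_dominated_convergence _ ?_ ?_
      (integrable_norm_rpow_smul_perp_gradient hβ.2 hg hsupp x).norm ?_
    · filter_upwards [self_mem_nhdsWithin] with ε hε
      exact (integrable_truncatedRiesz_smul hβ0 hε hg hsupp x).aestronglyMeasurable
    · filter_upwards [self_mem_nhdsWithin] with ε (hε : 0 < ε)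
      filter_upwards [hne] with y hy
      have hpos : 0 ≤ truncatedRiesz β ε (x - y) := by
        unfold truncatedRiesz
        positivity
      rw [norm_smul, norm_smul, Real.norm_of_nonneg hpos, Real.norm_of_nonneg (by positivity)]
      gcongr
      exact truncatedRiesz_le hβ0 hy
    · filter_upwards [hne] with y hy
      have hlt : ∀ᶠ ε : ℝ in 𝓝[>] 0, ε < ‖x - y‖ :=
        nhdsWithin_le_nhds (gt_mem_nhds (norm_pos_iff.2 hy))
      refine tendsto_const_nhds.congr' ?_
      filter_upwards [hlt] with ε hε
      rw [truncatedRiesz, max_eq_right hε.le]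
  refine (hlim.const_smul (-(1 / β))).congr' ?_
  filter_upwards [self_mem_nhdsWithin] with ε hε
  exact (setIntegral_smul_gsqgKernel hβ0 hε hg hsupp x).symm
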